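/- arXiv:1604.05516 — 12 statements merged into one kernel-verified Lean document; each statement's English description precedes it below -/
import Mathlib

section
/- Let a ∈ ℝ, b > 0 and τ > 0 satisfy ln(bτ) + aτ + 1 > 0. Then the characteristic equation λ + a + b e^{−λτ} = 0 has no real solution λ. -/
/-- If `a ∈ ℝ`, `b > 0`, `τ > 0` satisfy `log(bτ) + aτ + 1 > 0`, then the
characteristic equation `λ + a + b e^{-λτ} = 0` has no real solution. -/
theorem stmt0 (a b τ : ℝ) (hb : 0 < b) (hτ : 0 < τ)
    (h : Real.log (b * τ) + a * τ + 1 > 0) :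
    ¬ ∃ lam : ℝ, lam + a + b * Real.exp (-(lam * τ)) = 0 := by
  rintro ⟨l, hl⟩
  have h1 := Real.add_one_le_exp (Real.log (b * τ) + -(l * τ))
  rw [Real.exp_add, Real.exp_log (mul_pos hb hτ)] at h1
  have h2 : (l + a + b * Real.exp (-(l * τ))) * τ = 0 := by rw [hl, zero_mul]
  have h3 : l * τ + a * τ + b * τ * Real.exp (-(l * τ)) = 0 := by
    rw [← h2]; ring
  linarith
end

section
/- Let a ≥ 0, b > 0 and τ > 0 satisfy ln(bτ) + aτ + 1 < 0. Then the characteristic equation λ + a + b e^{−λτ} = 0 has exactly two real solutions, and both are strictly negative. -/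
theorem three_zeros_aux (a b τ : ℝ) (hb : 0 < b) (hτ : 0 < τ) (p q r : ℝ)
    (hpq : p < q) (hqr : q < r)
    (hp : p + a + b * Real.exp (-(p * τ)) = 0)
    (hq : q + a + b * Real.exp (-(q * τ)) = 0)
    (hr : r + a + b * Real.exp (-(r * τ)) = 0) : False := by
  have h1 : -(r * τ) < -(q * τ) := by nlinarith
  have h2 : -(q * τ) < -(p * τ) := by nlinarith
  have key := strictConvexOn_exp.slope_strict_mono_adjacent
    (Set.mem_univ (-(r * τ))) (Set.mem_univ (-(p * τ))) h1 h2
  rw [div_lt_div_iff₀ (by linarith) (by linarith)] at key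
  have k2 := mul_lt_mul_of_pos_left key hb
  have e1 : b * Real.exp (-(p * τ)) = -(p + a) := by linarith
  have e2 : b * Real.exp (-(q * τ)) = -(q + a) := by linarith
  have e3 : b * Real.exp (-(r * τ)) = -(r + a) := by linarith
  rw [← mul_assoc, ← mul_assoc, mul_sub b, mul_sub b, e1, e2, e3] at k2
  nlinarith

/-- If `a ≥ 0`, `b > 0`, `τ > 0` satisfy `log(bτ) + aτ + 1 < 0`, then the
characteristic equation `λ + a + b e^{-λτ} = 0` has exactly two real solutions,
and both are strictly negative. -/
theorem stmt1 (a b τ : ℝ) (ha : 0 ≤ a) (hb : 0 < b) (hτ : 0 < τ)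
    (h : Real.log (b * τ) + a * τ + 1 < 0) :
    ∃ x y : ℝ, x ≠ y ∧ x < 0 ∧ y < 0 ∧
      x + a + b * Real.exp (-(x * τ)) = 0 ∧
      y + a + b * Real.exp (-(y * τ)) = 0 ∧
      ∀ z : ℝ, z + a + b * Real.exp (-(z * τ)) = 0 → z = x ∨ z = y := by
  have hbt : 0 < b * τ := mul_pos hb hτ
  have hat : 0 ≤ a * τ := mul_nonneg ha hτ.le
  obtain ⟨m, hm⟩ : ∃ m, m = Real.log (b * τ) / τ := ⟨_, rfl⟩
  have hmt : m * τ = Real.log (b * τ) := by rw [hm]; field_simp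
  have hm0 : m < 0 := by
    rw [hm]; exact div_neg_of_neg_of_pos (by linarith) hτ
  obtain ⟨u, hu⟩ : ∃ u, u = 2 / (b * τ) := ⟨_, rfl⟩
  have hu0 : 0 < u := by rw [hu]; positivity
  have hub : u * (b * τ) = 2 := by rw [hu]; field_simp
  obtain ⟨p, hp⟩ : ∃ p, p = -u / τ := ⟨_, rfl⟩
  have hpt : p * τ = -u := by rw [hp]; field_simp
  have hpm : p < m := by
    have h1 := Real.log_le_sub_one_of_pos (inv_pos.mpr hbt)
    rw [Real.log_inv] at h1
    have h2 : u = 2 * (b * τ)⁻¹ := by rw [hu]; rfl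
    have : p * τ < m * τ := by rw [hpt, hmt]; linarith
    exact lt_of_mul_lt_mul_right this hτ.le
  have hc : Continuous (fun z : ℝ => z + a + b * Real.exp (-(z * τ))) := by fun_prop
  have fm : m + a + b * Real.exp (-(m * τ)) < 0 := by
    have : (m + a + b * Real.exp (-(m * τ))) * τ < 0 := by
      rw [hmt, Real.exp_neg, Real.exp_log hbt]
      have : b * (b * τ)⁻¹ * τ = 1 := by field_simp
      nlinarith
    exact neg_of_mul_neg_left this hτ.le
  have f0 : 0 < (0:ℝ) + a + b * Real.exp (-(0 * τ)) := by simp; linarith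
  have fp : 0 < p + a + b * Real.exp (-(p * τ)) := by
    have : 0 < (p + a + b * Real.exp (-(p * τ))) * τ := by
      rw [add_mul, add_mul, hpt, neg_neg]
      have := Real.quadratic_le_exp_of_nonneg hu0.le
      have h3 := mul_le_mul_of_nonneg_left this hbt.le
      have h4 : b * τ * (1 + u + u ^ 2 / 2) = b * τ + u * (b * τ) + u * (u * (b * τ)) / 2 := by
        ring
      rw [h4, hub] at h3
      linarith
    exact pos_of_mul_pos_left this hτ.le
  obtain ⟨x, hx, hfx⟩ := intermediate_value_Ioo' hpm.le hc.continuousOn ⟨fm, fp⟩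
  obtain ⟨y, hy, hfy⟩ := intermediate_value_Ioo hm0.le hc.continuousOn ⟨fm, f0⟩
  have hxy : x < y := hx.2.trans hy.1
  refine ⟨x, y, hxy.ne, hx.2.trans hm0, hy.2, hfx, hfy, fun z hz => ?_⟩
  rcases lt_trichotomy z x with h1 | h1 | h1
  · exact (three_zeros_aux a b τ hb hτ z x y h1 hxy hz hfx hfy).elim
  · exact Or.inl h1
  rcases lt_trichotomy z y with h2 | h2 | h2
  · exact (three_zeros_aux a b τ hb hτ x z y h1 h2 hfx hz hfy).elim
  · exact Or.inr h2
  · exact (three_zeros_aux a b τ hb hτ x y z hxy h2 hfx hfy hz).elim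
end

section
/- Let 0 ≤ a < b and τ > 0. Then every complex root λ of the characteristic equation λ + a + b e^{−λτ} = 0 has strictly negative real part if and only if τ√(b² − a²) < arccos(−a/b). -/
theorem aux_iff (a b τ x y : ℝ) :
    ((⟨x, y⟩ : ℂ) + (a : ℂ) + (b : ℂ) * Complex.exp (-((⟨x, y⟩ : ℂ) * (τ : ℂ))) = 0) ↔
      (x + a + b * (Real.exp (-(x * τ)) * Real.cos (y * τ)) = 0 ∧
        y - b * (Real.exp (-(x * τ)) * Real.sin (y * τ)) = 0) := by
  rw [Complex.ext_iff]
  simp [Complex.exp_re, Complex.exp_im, sub_eq_add_neg]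

/-- For `0 ≤ a < b` and `τ > 0`, every complex root of `λ + a + b e^{-λτ} = 0`
has strictly negative real part iff `τ √(b² - a²) < arccos(-a/b)`. -/
theorem stmt4 (a b τ : ℝ) (ha : 0 ≤ a) (hab : a < b) (hτ : 0 < τ) :
    (∀ lam : ℂ, lam + (a : ℂ) + (b : ℂ) * Complex.exp (-(lam * (τ : ℂ))) = 0 →
        lam.re < 0) ↔
      τ * Real.sqrt (b ^ 2 - a ^ 2) < Real.arccos (-a / b) := by
  have hb : 0 < b := lt_of_le_of_lt ha hab
  constructor
  · intro h
    by_contra! hge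
    let u : ℝ → ℝ := fun x => (x + a) * Real.exp (x * τ) / b
    let g : ℝ → ℝ := fun x =>
      τ * (b * Real.exp (-(x * τ)) * Real.sqrt (1 - u x ^ 2)) - Real.arccos (-u x)
    have hu : Continuous u := by
      simp only [u]; fun_prop
    have hg : Continuous g := by
      have := Real.continuous_arccos.comp hu.neg
      have h2 : Continuous fun x => Real.sqrt (1 - u x ^ 2) := by fun_prop
      have h3 : Continuous fun x : ℝ => Real.exp (-(x * τ)) := by fun_prop
      exact (continuous_const.mul ((continuous_const.mul h3).mul h2)).sub this
    have hjunk : ∀ x, 1 ≤ u x → g x = -Real.pi := by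
      intro x hx
      have h1 : Real.sqrt (1 - u x ^ 2) = 0 := Real.sqrt_eq_zero_of_nonpos (by nlinarith)
      have h2 : Real.arccos (-u x) = Real.pi := Real.arccos_of_le_neg_one (by linarith)
      simp only [g, h1, h2]; ring
    have hub : 1 ≤ u b := by
      simp only [u]
      rw [le_div_iff₀ hb]
      have : 1 ≤ Real.exp (b * τ) := Real.one_le_exp (by positivity)
      nlinarith
    have hg0 : 0 ≤ g 0 := by
      have hu0 : u 0 = a / b := by simp [u]
      have : b * Real.sqrt (1 - (a / b) ^ 2) = Real.sqrt (b ^ 2 - a ^ 2) := by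
        have : b ^ 2 - a ^ 2 = b ^ 2 * (1 - (a / b) ^ 2) := by field_simp
        rw [this, Real.sqrt_mul (by positivity), Real.sqrt_sq hb.le]
      simp only [g, hu0]
      rw [zero_mul, neg_zero, Real.exp_zero, mul_one, this, ← neg_div]
      linarith
    have hgb : g b ≤ 0 := by rw [hjunk b hub]; linarith [Real.pi_pos]
    obtain ⟨x, hx, hgx⟩ := intermediate_value_Icc' hb.le hg.continuousOn ⟨hgb, hg0⟩
    have hx0 : 0 ≤ x := hx.1
    have hux : u x < 1 := by
      by_contra! hc
      have := hjunk x hc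
      linarith [Real.pi_pos]
    have hux0 : 0 ≤ u x := by simp only [u]; positivity
    have hy : b * Real.exp (-(x * τ)) * Real.sqrt (1 - u x ^ 2) * τ = Real.arccos (-u x) := by
      simp only [g] at hgx
      linarith
    have := h ⟨x, b * Real.exp (-(x * τ)) * Real.sqrt (1 - u x ^ 2)⟩ (by
      rw [aux_iff, hy, Real.cos_arccos (by linarith) (by linarith), Real.sin_arccos]
      constructor
      · simp only [u]
        rw [Real.exp_neg]
        have := Real.exp_pos (x * τ)
        field_simp
        ring
      · rw [neg_sq]; ring)
    simp only at this
    linarith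
  · rintro h ⟨x, y⟩ hl
    rw [aux_iff] at hl
    obtain ⟨h1, h2⟩ := hl
    by_contra! hx
    simp only at hx
    have he : Real.exp (-(x * τ)) ≤ 1 := Real.exp_le_one_iff.2 (by nlinarith)
    have he0 := Real.exp_pos (-(x * τ))
    set e := Real.exp (-(x * τ))
    have hmod : (x + a) ^ 2 + y ^ 2 = b ^ 2 * e ^ 2 := by
      have e1 : x + a = -(b * (e * Real.cos (y * τ))) := by linarith
      have e2 : y = b * (e * Real.sin (y * τ)) := by linarith
      have e3 := Real.sin_sq_add_cos_sq (y * τ)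
      calc (x + a) ^ 2 + y ^ 2 = (b * (e * Real.cos (y * τ))) ^ 2
            + (b * (e * Real.sin (y * τ))) ^ 2 := by rw [← e2, e1]; ring
        _ = b ^ 2 * e ^ 2 * (Real.sin (y * τ) ^ 2 + Real.cos (y * τ) ^ 2) := by ring
        _ = _ := by rw [e3, mul_one]
    have hy : |y| ≤ Real.sqrt (b ^ 2 - a ^ 2) := by
      apply Real.abs_le_sqrt
      have : e ^ 2 ≤ 1 := by nlinarith
      have : b ^ 2 * e ^ 2 ≤ b ^ 2 := by nlinarith [sq_nonneg b]
      nlinarith [mul_nonneg hx ha]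
    have hyt : |y * τ| < Real.arccos (-a / b) := by
      rw [abs_mul, abs_of_pos hτ]
      nlinarith
    have hcos : -a / b < Real.cos (y * τ) := by
      rw [← Real.cos_abs (y * τ)]
      have := Real.cos_lt_cos_of_nonneg_of_le_pi (abs_nonneg _) (Real.arccos_le_pi _) hyt
      rwa [Real.cos_arccos] at this
      · rw [le_div_iff₀ hb]; linarith
      · rw [div_le_iff₀ hb]; linarith
    rw [div_lt_iff₀ hb] at hcos
    nlinarith [mul_pos he0 (by linarith : 0 < Real.cos (y * τ) * b + a),
      mul_nonneg ha (by linarith : 0 ≤ 1 - e)]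
end

section
/- Let 0 ≤ a < b and τ > 0 satisfy bτ < π/2. Then every complex root λ of the characteristic equation λ + a + b e^{−λτ} = 0 has strictly negative real part. -/
/-- For `0 ≤ a < b` and `τ > 0` with `bτ < π/2`, every complex root of
`λ + a + b e^{-λτ} = 0` has strictly negative real part. -/
theorem stmt5 (a b τ : ℝ) (ha : 0 ≤ a) (hab : a < b) (hτ : 0 < τ)
    (h : b * τ < Real.pi / 2) :
    ∀ lam : ℂ, lam + (a : ℂ) + (b : ℂ) * Complex.exp (-(lam * (τ : ℂ))) = 0 →
      lam.re < 0 := by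
  intro lam hl
  by_contra hx
  have hx : 0 ≤ lam.re := not_lt.mp hx
  have hre := congrArg Complex.re hl
  have him := congrArg Complex.im hl
  simp [Complex.exp_re, Complex.exp_im] at hre him
  have hb : 0 < b := lt_of_le_of_lt ha hab
  have he0 : 0 < Real.exp (-(lam.re * τ)) := Real.exp_pos _
  have he1 : Real.exp (-(lam.re * τ)) ≤ 1 :=
    Real.exp_le_one_iff.mpr (by have := mul_nonneg hx hτ.le; linarith)
  have hy : |lam.im| ≤ b := by
    have h1 : lam.im = b * (Real.exp (-(lam.re * τ)) * Real.sin (lam.im * τ)) := by linarith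
    rw [h1, abs_mul, abs_mul, abs_of_pos hb, abs_of_pos he0]
    have := mul_le_one₀ he1 (abs_nonneg _) (Real.abs_sin_le_one (lam.im * τ))
    nlinarith
  obtain ⟨h1, h2⟩ := abs_le.mp hy
  have hc : 0 < Real.cos (lam.im * τ) :=
    Real.cos_pos_of_mem_Ioo ⟨by nlinarith, by nlinarith⟩
  have := mul_pos hb (mul_pos he0 hc)
  linarith
end

section
/- Let a ≥ 0, c > 0 and b − c > a. Define ω₁ = √((b + c)² − a²), ω₂ = √((b − c)² − a²), τ₁ = arccos(−a/(b + c))/ω₁ and τ₂ = arccos(−a/(b − c))/ω₂. Then τ₁ < τ₂. -/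
/-- For `a ≥ 0`, `c > 0`, `b - c > a`, the critical delays
`τ₁ = arccos(-a/(b+c))/√((b+c)² - a²)` and `τ₂ = arccos(-a/(b-c))/√((b-c)² - a²)`
satisfy `τ₁ < τ₂`. -/
theorem stmt9 (a b c : ℝ) (ha : 0 ≤ a) (hc : 0 < c) (h : a < b - c) :
    Real.arccos (-a / (b + c)) / Real.sqrt ((b + c) ^ 2 - a ^ 2) <
      Real.arccos (-a / (b - c)) / Real.sqrt ((b - c) ^ 2 - a ^ 2) := by
  have hx : 0 < b - c := lt_of_le_of_lt ha h
  have hxy : b - c < b + c := by linarith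
  have h1 : Real.arccos (-a / (b + c)) ≤ Real.arccos (-a / (b - c)) := by
    apply Real.arccos_le_arccos
    rw [neg_div, neg_div]
    exact neg_le_neg (div_le_div_of_nonneg_left ha hx hxy.le)
  have h2 : 0 < Real.arccos (-a / (b - c)) := by
    rw [Real.arccos_pos]
    have : -a / (b - c) ≤ 0 := div_nonpos_of_nonpos_of_nonneg (by linarith) hx.le
    linarith
  have h3 : 0 < (b - c) ^ 2 - a ^ 2 := by nlinarith
  have h4 : Real.sqrt ((b - c) ^ 2 - a ^ 2) < Real.sqrt ((b + c) ^ 2 - a ^ 2) :=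
    Real.sqrt_lt_sqrt h3.le (by nlinarith)
  have h5 := Real.sqrt_pos.2 h3
  calc _ ≤ Real.arccos (-a / (b - c)) / Real.sqrt ((b + c) ^ 2 - a ^ 2) :=
        div_le_div_of_nonneg_right h1 (h5.trans h4).le
    _ < _ := div_lt_div_of_pos_left h2 h5 h4
end

section
/- Let a ≥ 0, b > c > 0 with b + c > a, set ω₁ = √((b + c)² − a²) and τ₁ = arccos(−a/(b + c))/ω₁. Then for every τ with 0 < τ < τ₁, the characteristic equation (λ + a + b e^{−λτ})² − c² e^{−2λτ} = 0 has no root λ on the imaginary axis (i.e., no root with Re λ = 0). -/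
theorem stmt10_aux (a k K : ℝ) (ha : 0 ≤ a) (hk : 0 < k) (hkK : k ≤ K)
    (h : a < K) (τ : ℝ) (hτ : 0 < τ)
    (hτ1 : τ < Real.arccos (-a / K) / Real.sqrt (K ^ 2 - a ^ 2)) (w : ℝ)
    (h1 : a + k * Real.cos (w * τ) = 0) (h2 : w = k * Real.sin (w * τ)) : False := by
  have hK : 0 < K := by linarith
  have hs : 0 < Real.sqrt (K ^ 2 - a ^ 2) := Real.sqrt_pos.mpr (by nlinarith)
  rw [lt_div_iff₀ hs] at hτ1
  have hw2 : w ^ 2 = k ^ 2 - a ^ 2 := by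
    have h3 : a = -(k * Real.cos (w * τ)) := by linarith
    have h4 := Real.sin_sq_add_cos_sq (w * τ)
    have h5 : w ^ 2 = (k * Real.sin (w * τ)) ^ 2 := by rw [← h2]
    have h6 : a ^ 2 = (k * Real.cos (w * τ)) ^ 2 := by
      have := congrArg (fun x => x ^ 2) h3
      simpa using this
    linear_combination h5 + h6 + k ^ 2 * h4
  have hle : |w| ≤ Real.sqrt (K ^ 2 - a ^ 2) := by
    apply Real.abs_le_sqrt
    nlinarith
  have hlt : |w| * τ < Real.arccos (-a / K) := by nlinarith
  have hcos : Real.cos (|w| * τ) = Real.cos (w * τ) := by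
    rw [← Real.cos_abs (w * τ), abs_mul, abs_of_pos hτ]
  have hc := Real.cos_lt_cos_of_nonneg_of_le_pi (by positivity) (Real.arccos_le_pi _) hlt
  rw [Real.cos_arccos (by rw [le_div_iff₀ hK]; linarith) (by rw [div_le_iff₀ hK]; linarith),
    hcos, div_lt_iff₀ hK] at hc
  have hneg : Real.cos (w * τ) ≤ 0 := by
    by_contra hh
    push Not at hh
    nlinarith [mul_pos hk hh]
  nlinarith

theorem stmt10_aux2 (a k τ : ℝ) (lam : ℂ) (hre : lam.re = 0)
    (h : lam + (a : ℂ) + (k : ℂ) * Complex.exp (-(lam * (τ : ℂ))) = 0) :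
    a + k * Real.cos (lam.im * τ) = 0 ∧ lam.im = k * Real.sin (lam.im * τ) := by
  have h1 := congrArg Complex.re h
  have h2 := congrArg Complex.im h
  simp [Complex.exp_re, Complex.exp_im, hre] at h1 h2
  exact ⟨h1, by linarith⟩


/-- For `a ≥ 0`, `b > c > 0`, `b + c > a`, and any delay `τ` with
`0 < τ < τ₁ = arccos(-a/(b+c))/√((b+c)² - a²)`, the characteristic equation
`(λ + a + b e^{-λτ})² - c² e^{-2λτ} = 0` has no root on the imaginary axis. -/
theorem stmt10 (a b c : ℝ) (ha : 0 ≤ a) (hc : 0 < c) (hcb : c < b)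
    (h : a < b + c) (τ : ℝ) (hτ : 0 < τ)
    (hτ1 : τ < Real.arccos (-a / (b + c)) / Real.sqrt ((b + c) ^ 2 - a ^ 2)) :
    ∀ lam : ℂ,
      (lam + (a : ℂ) + (b : ℂ) * Complex.exp (-(lam * (τ : ℂ)))) ^ 2 -
          (c : ℂ) ^ 2 * Complex.exp (-(2 * lam * (τ : ℂ))) = 0 →
        lam.re ≠ 0 := by

  intro lam hl hre
  have he : Complex.exp (-(2 * lam * (τ : ℂ))) = Complex.exp (-(lam * (τ : ℂ))) ^ 2 := by
    rw [← Complex.exp_nat_mul]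
    congr 1
    push_cast
    ring
  rw [he] at hl
  have hf : (lam + (a : ℂ) + ((b + c : ℝ) : ℂ) * Complex.exp (-(lam * (τ : ℂ)))) *
      (lam + (a : ℂ) + ((b - c : ℝ) : ℂ) * Complex.exp (-(lam * (τ : ℂ)))) = 0 := by
    push_cast
    linear_combination hl
  rcases mul_eq_zero.mp hf with h0 | h0
  · obtain ⟨h1, h2⟩ := stmt10_aux2 a _ τ lam hre h0
    exact stmt10_aux a (b + c) (b + c) ha (by linarith) le_rfl h τ hτ hτ1 _ h1 h2
  · obtain ⟨h1, h2⟩ := stmt10_aux2 a _ τ lam hre h0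
    exact stmt10_aux a (b - c) (b + c) ha (by linarith) (by linarith) h τ hτ hτ1 _ h1 h2
end

section
/- Let a, b, c, d be real numbers, τ > 0, and suppose λ = iω with ω real is a root of the characteristic equation λ² + aλ + bλ e^{−λτ} + c e^{−λτ} + d = 0. Then ω satisfies the quartic equation ω⁴ − (2d − a² + b²) ω² + (d² − c²) = 0. -/
/-- If `λ = iω` (with `ω` real) is a root of
`λ² + aλ + bλ e^{-λτ} + c e^{-λτ} + d = 0`, then
`ω⁴ - (2d - a² + b²) ω² + (d² - c²) = 0`. -/
theorem stmt12 (a b c d τ ω : ℝ) (hτ : 0 < τ)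
    (h : (Complex.I * (ω : ℂ)) ^ 2 + (a : ℂ) * (Complex.I * (ω : ℂ)) +
        (b : ℂ) * (Complex.I * (ω : ℂ)) * Complex.exp (-(Complex.I * (ω : ℂ) * (τ : ℂ))) +
        (c : ℂ) * Complex.exp (-(Complex.I * (ω : ℂ) * (τ : ℂ))) + (d : ℂ) = 0) :
    ω ^ 4 - (2 * d - a ^ 2 + b ^ 2) * ω ^ 2 + (d ^ 2 - c ^ 2) = 0 := by
  have hE : Complex.exp (-(Complex.I * (ω : ℂ) * (τ : ℂ))) =
      (Real.cos (ω * τ) : ℂ) - (Real.sin (ω * τ) : ℂ) * Complex.I := by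
    have : -(Complex.I * (ω : ℂ) * (τ : ℂ)) = (-((ω * τ : ℝ) : ℂ)) * Complex.I := by
      push_cast; ring
    rw [this, Complex.exp_mul_I, Complex.cos_neg, Complex.sin_neg, Complex.ofReal_cos,
      Complex.ofReal_sin]
    ring
  rw [hE] at h
  have hxy := Real.sin_sq_add_cos_sq (ω * τ)
  generalize Real.cos (ω * τ) = x at h hxy
  generalize Real.sin (ω * τ) = y at h hxy
  have h1 := congrArg Complex.re h
  have h2 := congrArg Complex.im h
  simp [pow_two] at h1 h2
  have e1 : d - ω ^ 2 = -(b * ω * y) - c * x := by linarith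
  have e2 : a * ω = c * y - b * ω * x := by linarith
  have : (d - ω ^ 2) ^ 2 + (a * ω) ^ 2 = (b ^ 2 * ω ^ 2 + c ^ 2) * (y ^ 2 + x ^ 2) := by
    rw [e1, e2]; ring
  rw [hxy] at this
  linarith
end

section
/- Let a, b, c, d be real numbers with b² ω² + c² ≠ 0 for a given ω > 0, and suppose ω satisfies ω⁴ − (2d − a² + b²) ω² + (d² − c²) = 0. Then there exists τ > 0 such that λ = iω is a root of the characteristic equation λ² + aλ + bλ e^{−λτ} + c e^{−λτ} + d = 0; moreover cos(ωτ) = (ω²(c − ab) − cd)/(b²ω² + c²) at any such crossing. -/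
lemma char_iff (a b c d ω τ : ℝ) :
    ((Complex.I * (ω : ℂ)) ^ 2 + (a : ℂ) * (Complex.I * (ω : ℂ)) +
        (b : ℂ) * (Complex.I * (ω : ℂ)) * Complex.exp (-(Complex.I * (ω : ℂ) * (τ : ℂ))) +
        (c : ℂ) * Complex.exp (-(Complex.I * (ω : ℂ) * (τ : ℂ))) + (d : ℂ) = 0) ↔
    (-ω ^ 2 + d + c * Real.cos (ω * τ) + b * ω * Real.sin (ω * τ) = 0 ∧
      a * ω + b * ω * Real.cos (ω * τ) - c * Real.sin (ω * τ) = 0) := by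
  have he : Complex.exp (-(Complex.I * (ω : ℂ) * (τ : ℂ))) =
      (Real.cos (ω * τ) : ℂ) - (Real.sin (ω * τ) : ℂ) * Complex.I := by
    have : -(Complex.I * (ω : ℂ) * (τ : ℂ)) = ((-(ω * τ) : ℝ) : ℂ) * Complex.I := by
      push_cast; ring
    rw [this, Complex.exp_mul_I, ← Complex.ofReal_cos, ← Complex.ofReal_sin,
      Real.cos_neg, Real.sin_neg]
    push_cast; ring
  rw [he]
  generalize Real.cos (ω * τ) = C
  generalize Real.sin (ω * τ) = S
  have h2 : (Complex.I * (ω : ℂ)) ^ 2 + (a : ℂ) * (Complex.I * (ω : ℂ)) +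
        (b : ℂ) * (Complex.I * (ω : ℂ)) * ((C : ℂ) - (S : ℂ) * Complex.I) +
        (c : ℂ) * ((C : ℂ) - (S : ℂ) * Complex.I) + (d : ℂ) =
      ((-ω ^ 2 + d + c * C + b * ω * S : ℝ) : ℂ) +
        ((a * ω + b * ω * C - c * S : ℝ) : ℂ) * Complex.I := by
    push_cast
    linear_combination ((ω : ℂ) ^ 2 - b * ω * S) * Complex.I_sq
  rw [h2, Complex.ext_iff]
  simp only [Complex.add_re, Complex.add_im, Complex.re_ofReal_mul, Complex.im_ofReal_mul,
    Complex.ofReal_re, Complex.ofReal_im, Complex.I_re, Complex.I_im, Complex.zero_re,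
    Complex.zero_im, mul_zero, mul_one, add_zero, zero_add]

/-- If `ω > 0` satisfies the quartic `ω⁴ - (2d - a² + b²)ω² + (d² - c²) = 0` and
`b²ω² + c² ≠ 0`, then there exists `τ > 0` such that `λ = iω` is a root of
`λ² + aλ + bλ e^{-λτ} + c e^{-λτ} + d = 0`; moreover at any such crossing
`cos(ωτ) = (ω²(c - ab) - cd)/(b²ω² + c²)`. -/
theorem stmt13 (a b c d ω : ℝ) (hω : 0 < ω)
    (hne : b ^ 2 * ω ^ 2 + c ^ 2 ≠ 0)
    (hq : ω ^ 4 - (2 * d - a ^ 2 + b ^ 2) * ω ^ 2 + (d ^ 2 - c ^ 2) = 0) :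
    (∃ τ : ℝ, 0 < τ ∧
      (Complex.I * (ω : ℂ)) ^ 2 + (a : ℂ) * (Complex.I * (ω : ℂ)) +
        (b : ℂ) * (Complex.I * (ω : ℂ)) * Complex.exp (-(Complex.I * (ω : ℂ) * (τ : ℂ))) +
        (c : ℂ) * Complex.exp (-(Complex.I * (ω : ℂ) * (τ : ℂ))) + (d : ℂ) = 0) ∧
    (∀ τ : ℝ, 0 < τ →
      (Complex.I * (ω : ℂ)) ^ 2 + (a : ℂ) * (Complex.I * (ω : ℂ)) +
        (b : ℂ) * (Complex.I * (ω : ℂ)) * Complex.exp (-(Complex.I * (ω : ℂ) * (τ : ℂ))) +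
        (c : ℂ) * Complex.exp (-(Complex.I * (ω : ℂ) * (τ : ℂ))) + (d : ℂ) = 0 →
      Real.cos (ω * τ) =
        (ω ^ 2 * (c - a * b) - c * d) / (b ^ 2 * ω ^ 2 + c ^ 2)) := by
  constructor
  · set N := b ^ 2 * ω ^ 2 + c ^ 2 with hN
    set C := (ω ^ 2 * (c - a * b) - c * d) / N with hC
    set S := (b * ω * (ω ^ 2 - d) + a * c * ω) / N with hS
    have hC' : C * N = ω ^ 2 * (c - a * b) - c * d := div_mul_cancel₀ _ hne
    have hS' : S * N = b * ω * (ω ^ 2 - d) + a * c * ω := div_mul_cancel₀ _ hne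
    have hCS : C ^ 2 + S ^ 2 = 1 := by
      apply mul_right_cancel₀ (pow_ne_zero 2 hne)
      have : (C ^ 2 + S ^ 2) * N ^ 2 = (C * N) ^ 2 + (S * N) ^ 2 := by ring
      rw [this, hC', hS', hN]
      linear_combination (b ^ 2 * ω ^ 2 + c ^ 2) * hq
    have hz : ‖(⟨C, S⟩ : ℂ)‖ = 1 := by
      have h := Complex.sq_norm (⟨C, S⟩ : ℂ)
      rw [Complex.normSq_mk] at h
      have h0 := norm_nonneg (⟨C, S⟩ : ℂ)
      nlinarith
    have hz0 : (⟨C, S⟩ : ℂ) ≠ 0 := by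
      intro h; rw [h] at hz; simp at hz
    have hc := Complex.cos_arg hz0
    have hs := Complex.sin_arg (⟨C, S⟩ : ℂ)
    rw [hz, div_one] at hc hs
    have hpi := Complex.neg_pi_lt_arg (⟨C, S⟩ : ℂ)
    have hp := Real.pi_pos
    refine ⟨(Complex.arg ⟨C, S⟩ + 2 * Real.pi) / ω, div_pos (by linarith) hω, ?_⟩
    rw [char_iff, mul_div_cancel₀ _ hω.ne', Real.cos_add_two_pi, Real.sin_add_two_pi, hc, hs]
    constructor
    · apply mul_right_cancel₀ hne
      show (-ω ^ 2 + d + c * C + b * ω * S) * N = 0 * N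
      linear_combination c * hC' + b * ω * hS' + (d - ω ^ 2) * hN
    · apply mul_right_cancel₀ hne
      show (a * ω + b * ω * C - c * S) * N = 0 * N
      linear_combination b * ω * hC' - c * hS' + a * ω * hN
  · intro τ _ h
    rw [char_iff] at h
    obtain ⟨h1, h2⟩ := h
    rw [eq_div_iff hne]
    linear_combination c * h1 + b * ω * h2
end

section
/- Let a, b, c > 0 and 0 < d < c. Let ω be the unique positive solution of ω⁴ − (2d − a² + b²) ω² + (d² − c²) = 0 and set τ₁ = (1/ω) arccos( (ω²(c − ab) − cd)/(b²ω² + c²) ). Then for τ > 0, every complex root λ of the characteristic equation λ² + aλ + bλ e^{−λτ} + c e^{−λτ} + d = 0 has strictly negative real part if and only if τ < τ₁. -/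
open Filter Topology Metric Set

noncomputable def chF (a b c d : ℝ) (τ : ℝ) (z : ℂ) : ℂ :=
  z ^ 2 + (a : ℂ) * z + (b : ℂ) * z * Complex.exp (-(z * (τ : ℂ))) +
          (c : ℂ) * Complex.exp (-(z * (τ : ℂ))) + (d : ℂ)

def chP (a b c d τ : ℝ) : Prop := ∃ z : ℂ, chF a b c d τ z = 0 ∧ 0 ≤ z.re

lemma chF_cont (a b c d : ℝ) : Continuous (fun p : ℝ × ℂ => chF a b c d p.1 p.2) := by
  unfold chF; fun_prop

lemma chF_diff (a b c d τ : ℝ) : Differentiable ℂ (chF a b c d τ) := by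
  unfold chF; fun_prop

lemma chF_zero (a b c d τ : ℝ) : chF a b c d τ 0 = (c + d : ℝ) := by
  simp [chF]

lemma chF_bound (a b c d τ : ℝ) (ha : 0 < a) (hb : 0 < b) (hc : 0 < c) (hd : 0 < d)
    (hτ : 0 ≤ τ) (z : ℂ) (hz : 0 ≤ z.re) (h : chF a b c d τ z = 0) :
    ‖z‖ ≤ a + b + c + d + 1 := by
  have he : ‖Complex.exp (-(z * (τ : ℂ)))‖ ≤ 1 := by
    rw [Complex.norm_exp]
    simp
    positivity
  have h1 : z ^ 2 = -((a : ℂ) * z + (b : ℂ) * z * Complex.exp (-(z * (τ : ℂ))) +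
          (c : ℂ) * Complex.exp (-(z * (τ : ℂ))) + (d : ℂ)) := by
    unfold chF at h; linear_combination h
  have h2 : ‖z‖ ^ 2 ≤ a * ‖z‖ + b * ‖z‖ + c + d := by
    rw [← norm_pow, h1, norm_neg]
    refine (norm_add_le _ _).trans ?_
    gcongr
    · refine (norm_add_le _ _).trans ?_
      gcongr
      · refine (norm_add_le _ _).trans ?_
        gcongr
        · simp [abs_of_pos ha]
        · rw [norm_mul, norm_mul, Complex.norm_real, Real.norm_of_nonneg hb.le]
          exact mul_le_of_le_one_right (by positivity) he
      · rw [norm_mul, Complex.norm_real, Real.norm_of_nonneg hc.le]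
        exact mul_le_of_le_one_right (by positivity) he
    · simp [abs_of_pos hd]
  by_contra! h3
  nlinarith [norm_nonneg z]

lemma chP_compact (a b c d : ℝ) (ha : 0 < a) (hb : 0 < b) (hc : 0 < c) (hd : 0 < d)
    (t1 t2 : ℝ) (h1 : 0 ≤ t1) : IsCompact {τ : ℝ | τ ∈ Icc t1 t2 ∧ chP a b c d τ} := by
  have hK : IsCompact ((Icc t1 t2 ×ˢ closedBall (0 : ℂ) (a + b + c + d + 1)) ∩
      {p : ℝ × ℂ | chF a b c d p.1 p.2 = 0 ∧ 0 ≤ p.2.re}) := by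
    refine (isCompact_Icc.prod (isCompact_closedBall _ _)).inter_right ?_
    refine (isClosed_eq (chF_cont a b c d) continuous_const).inter ?_
    exact isClosed_le continuous_const (Complex.continuous_re.comp continuous_snd)
  convert hK.image continuous_fst using 1
  ext τ
  constructor
  · rintro ⟨hτ, z, hz, hr⟩
    refine ⟨(τ, z), ⟨⟨hτ, ?_⟩, hz, hr⟩, rfl⟩
    simpa using chF_bound a b c d τ ha hb hc hd (h1.trans hτ.1) z hr hz
  · rintro ⟨⟨t, z⟩, ⟨⟨ht, _⟩, hz, hr⟩, rfl⟩
    exact ⟨ht, z, hz, hr⟩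

lemma chP_open (a b c d : ℝ) (hc : 0 < c) (hd : 0 < d)
    (s : ℝ) (z₀ : ℂ) (hz : chF a b c d s z₀ = 0) (hr : 0 < z₀.re) :
    ∀ᶠ τ in 𝓝 s, chP a b c d τ := by
  have han : ∀ τ, AnalyticOnNhd ℂ (chF a b c d τ) univ := fun τ =>
    (chF_diff a b c d τ).differentiableOn.analyticOnNhd isOpen_univ
  have hne : ∀ᶠ z in 𝓝[≠] z₀, chF a b c d s z ≠ 0 := by
    refine ((han s) z₀ (mem_univ _)).eventually_eq_zero_or_eventually_ne_zero.resolve_left ?_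
    intro h
    have := (han s).eqOn_zero_of_preconnected_of_eventuallyEq_zero isPreconnected_univ
      (mem_univ z₀) h (mem_univ 0)
    rw [chF_zero] at this
    simp only [Pi.zero_apply] at this
    have h2 : c + d = 0 := by exact_mod_cast this
    linarith
  rw [eventually_nhdsWithin_iff] at hne
  have hre : ∀ᶠ z : ℂ in 𝓝 z₀, 0 < z.re :=
    (Complex.continuous_re.tendsto z₀).eventually (lt_mem_nhds hr)
  obtain ⟨r, hr0, hball⟩ := Metric.nhds_basis_closedBall.eventually_iff.1 (hne.and hre)
  have hsph : ∀ z ∈ sphere z₀ r, chF a b c d s z ≠ 0 := fun z hz' =>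
    (hball (sphere_subset_closedBall hz')).1 (ne_of_mem_sphere hz' hr0.ne')
  have hcont : Continuous (fun z => ‖chF a b c d s z‖) := (chF_diff a b c d s).continuous.norm
  obtain ⟨w, hw, hmin⟩ := (isCompact_sphere z₀ r).exists_isMinOn
    (NormedSpace.sphere_nonempty.2 hr0.le) hcont.continuousOn
  set m := ‖chF a b c d s w‖ with hm
  have hm0 : 0 < m := norm_pos_iff.2 (hsph w hw)
  have e1 : ∀ᶠ τ in 𝓝 s, ∀ z ∈ sphere z₀ r, m / 2 < ‖chF a b c d τ z - chF a b c d τ z₀‖ := by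
    refine (isCompact_sphere z₀ r).eventually_forall_of_forall_eventually ?_
    intro z hz'
    have hC : Continuous (fun p : ℝ × ℂ => ‖chF a b c d p.1 p.2 - chF a b c d p.1 z₀‖) := by
      unfold chF; fun_prop
    refine (hC.tendsto (s, z)).eventually (lt_mem_nhds ?_)
    have : m ≤ ‖chF a b c d s z‖ := hmin hz'
    simp only [hz, sub_zero]
    linarith
  have e2 : ∀ᶠ τ in 𝓝 s, ‖chF a b c d τ z₀‖ < m / 2 / 2 := by
    have hC : Continuous (fun τ : ℝ => ‖chF a b c d τ z₀‖) := by
      unfold chF; fun_prop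
    refine (hC.tendsto s).eventually (gt_mem_nhds ?_)
    rw [hz, norm_zero]; positivity
  filter_upwards [e1, e2] with τ h1 h2
  have key := DiffContOnCl.ball_subset_image_closedBall (f := chF a b c d τ) (z₀ := z₀) (r := r)
    (ε := m / 2) (chF_diff a b c d τ).diffContOnCl hr0 (fun z hz' => (h1 z hz').le) ?_
  · obtain ⟨z, hz1, hz2⟩ := key (show (0 : ℂ) ∈ _ by simpa using h2)
    exact ⟨z, hz2, (hball hz1).2.le⟩
  · intro hev
    have hev' : (fun z => chF a b c d τ z - chF a b c d τ z₀) =ᶠ[𝓝 z₀] 0 := by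
      filter_upwards [hev] with z hz'
      have : chF a b c d τ z = chF a b c d τ z₀ := by simpa using hz'
      simp [this]
    have han' : AnalyticOnNhd ℂ (fun z => chF a b c d τ z - chF a b c d τ z₀) univ :=
      (han τ).sub analyticOnNhd_const
    have := han'.eqOn_zero_of_preconnected_of_eventuallyEq_zero isPreconnected_univ
      (mem_univ z₀) hev' (mem_univ w)
    have h3 := h1 w hw
    simp only [Pi.zero_apply] at this
    rw [this, norm_zero] at h3
    linarith

lemma ch_alg (p q p' b E s : ℂ) (hp : p ≠ 0) (hq : q ≠ 0) (h : -(p / q) * E = 1) :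
    -((p' * q - p * b) / q ^ 2) * E + -(p / q) * (E * s) = p' / p - b / q + s := by
  have hE : E = -(q / p) := by
    field_simp at h ⊢
    linear_combination -h
  rw [hE]
  field_simp

lemma chP_cross (a b c d : ℝ) (hc : 0 < c)
    (s y : ℝ) (hy : y ≠ 0) (hz : chF a b c d s (y * Complex.I) = 0)
    (hN : (d - y ^ 2) ^ 2 + a ^ 2 * y ^ 2 = c ^ 2 + b ^ 2 * y ^ 2)
    (hpos : 0 < 2 * y ^ 2 - (2 * d - a ^ 2 + b ^ 2)) :
    ∀ᶠ τ in 𝓝[>] s, chP a b c d τ := by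
  set z₀ : ℂ := y * Complex.I with hz₀
  have hz0 : z₀ ≠ 0 := by simp [hz₀, hy]
  have hq0 : (b : ℂ) * z₀ + c ≠ 0 := by
    intro h
    have := congrArg Complex.re h
    simp [hz₀] at this
    exact hc.ne' this
  have hD : 0 < c ^ 2 + b ^ 2 * y ^ 2 := by positivity
  have hp0 : z₀ ^ 2 + a * z₀ + d ≠ 0 := by
    intro h
    have h1 : (b * z₀ + c) * Complex.exp (-(z₀ * (s : ℂ))) = 0 := by
      unfold chF at hz; linear_combination hz - h
    exact (mul_ne_zero hq0 (Complex.exp_ne_zero _)) h1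
  set w : ℂ → ℂ := fun z => -((z ^ 2 + a * z + d) / (b * z + c)) * Complex.exp (z * s) with hw
  have hw1 : w z₀ = 1 := by
    have h2 : (z₀ ^ 2 + a * z₀ + d) = -((b * z₀ + c) * Complex.exp (-(z₀ * (s : ℂ)))) := by
      unfold chF at hz; linear_combination hz
    simp only [hw]
    rw [h2, neg_div, neg_neg, mul_div_cancel_left₀ _ hq0, ← Complex.exp_add]
    simp
  set W : ℂ := (2 * z₀ + a) / (z₀ ^ 2 + a * z₀ + d) - b / (b * z₀ + c) + s with hWdef
  have hwd : HasStrictDerivAt w W z₀ := by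
    have hp : HasStrictDerivAt (fun z : ℂ => z ^ 2 + a * z + d) (2 * z₀ + a) z₀ := by
      have := (((hasStrictDerivAt_id z₀).pow 2).add ((hasStrictDerivAt_id z₀).const_mul (a : ℂ))).add_const (d : ℂ)
      exact this.congr_deriv (by simp)
    have hqd : HasStrictDerivAt (fun z : ℂ => b * z + c) b z₀ := by
      have := ((hasStrictDerivAt_id z₀).const_mul (b : ℂ)).add_const (c : ℂ)
      exact this.congr_deriv (by simp)
    have hed : HasStrictDerivAt (fun z : ℂ => Complex.exp (z * s)) (Complex.exp (z₀ * s) * s) z₀ := by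
      have := ((hasStrictDerivAt_id z₀).mul_const (s : ℂ)).cexp
      exact this.congr_deriv (by simp)
    have hh := ((hp.div hqd hq0).neg).mul hed
    exact hh.congr_deriv (ch_alg _ _ _ _ _ _ hp0 hq0 hw1)
  have hslit : w z₀ ∈ Complex.slitPlane := by rw [hw1]; exact Complex.one_mem_slitPlane
  set h : ℂ → ℂ := fun z => s - Complex.log (w z) / z with hh
  have hhs : h z₀ = s := by simp [hh, hw1]
  have hhd : HasStrictDerivAt h (-(W / z₀)) z₀ := by
    have h1 := ((hwd.clog hslit).div (hasStrictDerivAt_id z₀) hz0).const_sub (s : ℂ)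
    refine h1.congr_deriv ?_
    simp only [hw1, Complex.log_one, id]
    field_simp
    simp
  have hWim : W.im = -(y * (2 * y ^ 2 - (2 * d - a ^ 2 + b ^ 2)) / (c ^ 2 + b ^ 2 * y ^ 2)) := by
    have n1 : Complex.normSq (z₀ ^ 2 + a * z₀ + d) = c ^ 2 + b ^ 2 * y ^ 2 := by
      rw [← hN, Complex.normSq_apply]
      simp [hz₀, pow_two]
      ring
    have n2 : Complex.normSq (b * z₀ + c) = c ^ 2 + b ^ 2 * y ^ 2 := by
      rw [Complex.normSq_apply]
      simp [hz₀]
      ring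
    rw [hWdef, Complex.add_im, Complex.sub_im, Complex.div_im, Complex.div_im, n1, n2]
    simp [hz₀, pow_two]
    field_simp
    ring
  have hder : (-(W / z₀)).re = (2 * y ^ 2 - (2 * d - a ^ 2 + b ^ 2)) / (c ^ 2 + b ^ 2 * y ^ 2) := by
    have : (-(W / z₀)).re = - W.im / y := by
      rw [hz₀, Complex.neg_re, Complex.div_re]
      simp [Complex.normSq_apply]
      field_simp
    rw [this, hWim]
    field_simp
  have hder0 : 0 < (-(W / z₀)).re := by rw [hder]; positivity
  have hd0 : -(W / z₀) ≠ 0 := by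
    intro h0; rw [h0] at hder0; simp at hder0
  set L := hhd.localInverse h (-(W / z₀)) z₀ hd0 with hL
  have hLd : HasStrictDerivAt L (-(W / z₀))⁻¹ (s : ℂ) := by
    rw [← hhs]; exact hhd.to_localInverse hd0
  have hLs : L s = z₀ := by
    rw [← hhs]; exact (hhd.eventually_left_inverse hd0).self_of_nhds
  have hLr : ∀ᶠ x in 𝓝 (s : ℂ), h (L x) = x := by
    have := hhd.eventually_right_inverse hd0
    rwa [hhs] at this
  have hLt : Tendsto L (𝓝 (s : ℂ)) (𝓝 z₀) := by
    have := hLd.hasDerivAt.continuousAt.tendsto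
    rwa [hLs] at this
  have hgood : ∀ᶠ z in 𝓝 z₀, z ≠ 0 ∧ (b : ℂ) * z + c ≠ 0 ∧ w z ≠ 0 := by
    refine (continuousAt_id.eventually_ne hz0).and
      ((ContinuousAt.eventually_ne (g := fun z : ℂ => (b : ℂ) * z + c) (by fun_prop) hq0).and
      (hwd.hasDerivAt.continuousAt.eventually_ne (by rw [hw1]; exact one_ne_zero)))
  have hcast : Tendsto (fun t : ℝ => (t : ℂ)) (𝓝[>] (s : ℝ)) (𝓝 (s : ℂ)) :=
    (Complex.continuous_ofReal.tendsto s).mono_left nhdsWithin_le_nhds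
  have hreal : HasDerivAt (fun t : ℝ => (L t).re) ((-(W / z₀))⁻¹).re s :=
    hLd.hasDerivAt.real_of_complex
  have hinv : 0 < ((-(W / z₀))⁻¹).re := by
    rw [Complex.inv_re]
    exact div_pos hder0 (Complex.normSq_pos.2 hd0)
  have hsgn := eventually_nhdsWithin_sign_eq_of_deriv_pos (f := fun t : ℝ => (L t).re) (x₀ := s)
    (by rw [hreal.deriv]; exact hinv) (by simp [hLs, hz₀])
  have hsgn' : ∀ᶠ t : ℝ in 𝓝[>] s, SignType.sign (L t).re = SignType.sign (t - s) :=
    hsgn.filter_mono nhdsWithin_le_nhds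
  filter_upwards [hcast.eventually hLr, hcast.eventually (hLt.eventually hgood), hsgn',
    self_mem_nhdsWithin] with t h1 h2 h3 h4
  obtain ⟨g1, g2, g3⟩ := h2
  refine ⟨L t, ?_, ?_⟩
  · set z := L t
    have e1 : Complex.log (w z) = z * s - z * t := by
      simp only [hh] at h1
      field_simp at h1
      linear_combination -h1
    have e2 : w z = Complex.exp (z * s) * Complex.exp (-(z * t)) := by
      rw [← Complex.exp_log g3, e1, ← Complex.exp_add]; ring_nf
    simp only [hw] at e2
    have e3 : -((z ^ 2 + a * z + d) / (b * z + c)) = Complex.exp (-(z * t)) := by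
      apply mul_right_cancel₀ (Complex.exp_ne_zero (z * s))
      rw [e2]; ring
    unfold chF
    have e4 : (z ^ 2 + a * z + d) / (b * z + c) * (b * z + c) = z ^ 2 + a * z + d :=
      div_mul_cancel₀ _ g2
    linear_combination (-(b * z + c)) * e3 - e4
  · have h5 : SignType.sign (t - s) = 1 := sign_pos (sub_pos.2 h4)
    rw [h5, sign_eq_one_iff] at h3
    exact h3.le

lemma ch_axis (a b c d s y : ℝ) (hz : chF a b c d s (y * Complex.I) = 0) :
    (d - y ^ 2) + b * y * Real.sin (y * s) + c * Real.cos (y * s) = 0 ∧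
    a * y + b * y * Real.cos (y * s) - c * Real.sin (y * s) = 0 := by
  have he : Complex.exp (-(y * Complex.I * (s : ℂ))) =
      (Real.cos (y * s) : ℂ) - (Real.sin (y * s) : ℂ) * Complex.I := by
    have : -(y * Complex.I * (s : ℂ)) = ((-(y * s) : ℝ) : ℂ) * Complex.I := by push_cast; ring
    rw [this, Complex.exp_mul_I, ← Complex.ofReal_cos, ← Complex.ofReal_sin, Real.cos_neg,
      Real.sin_neg]
    push_cast; ring
  unfold chF at hz
  rw [he] at hz
  have h1 := congrArg Complex.re hz
  have h2 := congrArg Complex.im hz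
  simp [pow_two, -Complex.ofReal_cos, -Complex.ofReal_sin] at h1 h2
  constructor <;> linarith

lemma ch_axis' (a b c d s y : ℝ)
    (h1 : (d - y ^ 2) + b * y * Real.sin (y * s) + c * Real.cos (y * s) = 0)
    (h2 : a * y + b * y * Real.cos (y * s) - c * Real.sin (y * s) = 0) :
    chF a b c d s (y * Complex.I) = 0 := by
  have he : Complex.exp (-(y * Complex.I * (s : ℂ))) =
      (Real.cos (y * s) : ℂ) - (Real.sin (y * s) : ℂ) * Complex.I := by
    have : -(y * Complex.I * (s : ℂ)) = ((-(y * s) : ℝ) : ℂ) * Complex.I := by push_cast; ring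
    rw [this, Complex.exp_mul_I, ← Complex.ofReal_cos, ← Complex.ofReal_sin, Real.cos_neg,
      Real.sin_neg]
    push_cast; ring
  unfold chF
  rw [he]
  apply Complex.ext
  · simp [pow_two, -Complex.ofReal_cos, -Complex.ofReal_sin]; linarith
  · simp [pow_two, -Complex.ofReal_cos, -Complex.ofReal_sin]; linarith

lemma ch_zero_delay (a b c d : ℝ) (ha : 0 < a) (hb : 0 < b) (hc : 0 < c) (hd : 0 < d) :
    ¬ chP a b c d 0 := by
  rintro ⟨z, hz, hr⟩
  unfold chF at hz
  have h1 := congrArg Complex.re hz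
  have h2 := congrArg Complex.im hz
  simp [pow_two] at h1 h2
  have h3 : z.im * (2 * z.re + a + b) = 0 := by linarith
  have h4 : z.im = 0 := by
    rcases mul_eq_zero.1 h3 with h | h
    · exact h
    · nlinarith
  rw [h4] at h1
  nlinarith [mul_nonneg ha.le hr, mul_nonneg hb.le hr, mul_self_nonneg z.re]


/-- For `a, b, c > 0`, `0 < d < c`, let `ω` be the unique positive solution of
`ω⁴ - (2d - a² + b²)ω² + (d² - c²) = 0` and set
`τ₁ = (1/ω) arccos((ω²(c - ab) - cd)/(b²ω² + c²))`. Then for `τ > 0`, every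
complex root of `λ² + aλ + bλ e^{-λτ} + c e^{-λτ} + d = 0` has strictly
negative real part iff `τ < τ₁`. -/
theorem stmt15 (a b c d ω : ℝ) (ha : 0 < a) (hb : 0 < b) (hc : 0 < c)
    (hd0 : 0 < d) (hdc : d < c) (hω : 0 < ω)
    (hq : ω ^ 4 - (2 * d - a ^ 2 + b ^ 2) * ω ^ 2 + (d ^ 2 - c ^ 2) = 0)
    (τ : ℝ) (hτ : 0 < τ) :
    (∀ lam : ℂ,
      lam ^ 2 + (a : ℂ) * lam + (b : ℂ) * lam * Complex.exp (-(lam * (τ : ℂ))) +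
          (c : ℂ) * Complex.exp (-(lam * (τ : ℂ))) + (d : ℂ) = 0 →
        lam.re < 0) ↔
      τ < (1 / ω) *
        Real.arccos ((ω ^ 2 * (c - a * b) - c * d) / (b ^ 2 * ω ^ 2 + c ^ 2)) := by
  have hω2 : 0 < ω ^ 2 - (2 * d - a ^ 2 + b ^ 2) := by
    have : 0 < ω ^ 2 * (ω ^ 2 - (2 * d - a ^ 2 + b ^ 2)) := by nlinarith
    exact pos_of_mul_pos_right this (by positivity)
  have hω2' : 0 < ω ^ 2 := by positivity
  have hD : 0 < b ^ 2 * ω ^ 2 + c ^ 2 := by positivity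
  set C := (ω ^ 2 * (c - a * b) - c * d) / (b ^ 2 * ω ^ 2 + c ^ 2) with hC
  set S := ω * (b * (ω ^ 2 - d) + a * c) / (b ^ 2 * ω ^ 2 + c ^ 2) with hS
  have hCS : C ^ 2 + S ^ 2 = 1 := by
    rw [hC, hS]
    field_simp
    linear_combination (b ^ 2 * ω ^ 2 + c ^ 2) * hq
  have hS0 : 0 ≤ S := by
    have : 0 ≤ b * (ω ^ 2 - d) + a * c := by
      by_contra! hneg
      have hab : a < b := by
        by_contra! hba
        nlinarith [mul_le_mul_of_nonneg_right hba hc.le, mul_pos hb hω2', mul_lt_mul_of_pos_left hdc hb]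
      -- x = d - a c / b > ω²
      set x := d - a * c / b with hx
      have hxω : ω ^ 2 < x := by
        rw [hx, lt_sub_iff_add_lt, ← lt_sub_iff_add_lt', div_lt_iff₀ hb]
        nlinarith
      have hF : x ^ 2 - (2 * d - a ^ 2 + b ^ 2) * x + (d ^ 2 - c ^ 2)
          = (a ^ 2 - b ^ 2) * (c ^ 2 / b ^ 2 + x) := by
        rw [hx]; field_simp; ring
      have hneg2 : (a ^ 2 - b ^ 2) * (c ^ 2 / b ^ 2 + x) < 0 := by
        apply mul_neg_of_neg_of_pos
        · nlinarith
        · have : 0 < c ^ 2 / b ^ 2 := by positivity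
          linarith
      nlinarith [mul_pos (sub_pos.2 hxω) (show 0 < x + ω ^ 2 - (2 * d - a ^ 2 + b ^ 2) by linarith)]
    rw [hS]; positivity
  have hC1 : -1 ≤ C := by nlinarith [sq_nonneg S]
  have hC2 : C ≤ 1 := by nlinarith [sq_nonneg S]
  -- facts about roots on the axis
  have haxis : ∀ s y : ℝ, chF a b c d s (y * Complex.I) = 0 →
      y ^ 2 = ω ^ 2 ∧ Real.cos (ω * s) = C := by
    intro s y hz
    obtain ⟨h1, h2⟩ := ch_axis a b c d s y hz
    have hsc := Real.sin_sq_add_cos_sq (y * s)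
    set u := Real.cos (y * s) with hu
    set v := Real.sin (y * s) with hv
    have hq' : (d - y ^ 2) ^ 2 + a ^ 2 * y ^ 2 = c ^ 2 + b ^ 2 * y ^ 2 := by
      have e1 : d - y ^ 2 = -(b * y * v + c * u) := by linarith
      have e2 : a * y = -(b * y * u - c * v) := by linarith
      rw [← mul_pow, e1, e2]
      linear_combination (c ^ 2 + b ^ 2 * y ^ 2) * hsc
    have hy2 : y ^ 2 = ω ^ 2 := by
      have : (y ^ 2 - ω ^ 2) * (y ^ 2 + (ω ^ 2 - (2 * d - a ^ 2 + b ^ 2))) = 0 := by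
        linear_combination hq' - hq
      rcases mul_eq_zero.1 this with h | h
      · linarith
      · nlinarith [sq_nonneg y]
    refine ⟨hy2, ?_⟩
    have hcos : Real.cos (ω * s) = u := by
      rcases sq_eq_sq_iff_eq_or_eq_neg.1 hy2 with h | h
      · rw [hu, h]
      · rw [hu, h, neg_mul, Real.cos_neg]
    rw [hcos, hC, eq_div_iff hD.ne', ← hy2]
    linear_combination c * h1 + b * y * h2
  have hτ1 : ∀ t, t < 1 / ω * Real.arccos C ↔ ω * t < Real.arccos C := by
    intro t
    rw [one_div, ← div_eq_inv_mul, lt_div_iff₀ hω, mul_comm]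
  have hroot : chP a b c d (1 / ω * Real.arccos C) := by
    refine ⟨ω * Complex.I, ?_, by simp⟩
    have e : ω * (1 / ω * Real.arccos C) = Real.arccos C := by field_simp
    have hsin : Real.sin (Real.arccos C) = S := by
      rw [Real.sin_arccos, show 1 - C ^ 2 = S ^ 2 by linarith, Real.sqrt_sq hS0]
    apply ch_axis'
    · rw [e, hsin, Real.cos_arccos hC1 hC2, hC, hS]
      field_simp
      ring
    · rw [e, hsin, Real.cos_arccos hC1 hC2, hC, hS]
      field_simp
      ring
  have hform : ∀ z : ℂ, z.re = 0 → z = (z.im : ℂ) * Complex.I := by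
    intro z hz
    apply Complex.ext <;> simp [hz]
  have hstep : (∀ lam : ℂ,
      lam ^ 2 + (a : ℂ) * lam + (b : ℂ) * lam * Complex.exp (-(lam * (τ : ℂ))) +
          (c : ℂ) * Complex.exp (-(lam * (τ : ℂ))) + (d : ℂ) = 0 →
        lam.re < 0) ↔ ¬ chP a b c d τ := by
    unfold chP chF
    push Not
    rfl
  rw [hstep]
  constructor
  · intro hno
    by_contra! hle
    have h0 : 0 ≤ 1 / ω * Real.arccos C := mul_nonneg (by positivity) (Real.arccos_nonneg _)
    obtain ⟨s, ⟨⟨hs1, hs2⟩, z, hz, hr⟩, hmax⟩ :=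
      (chP_compact a b c d ha hb hc hd0 (1 / ω * Real.arccos C) τ h0).exists_isGreatest
        ⟨_, ⟨le_rfl, hle⟩, hroot⟩
    have hsτ : s < τ := lt_of_le_of_ne hs2 (by rintro rfl; exact hno ⟨z, hz, hr⟩)
    have hev : ∀ᶠ t in 𝓝[>] s, chP a b c d t := by
      rcases hr.lt_or_eq with hr | hr
      · exact (chP_open a b c d hc hd0 s z hz hr).filter_mono nhdsWithin_le_nhds
      · rw [hform z hr.symm] at hz
        obtain ⟨hy, -⟩ := haxis s _ hz
        refine chP_cross a b c d hc s z.im ?_ hz ?_ ?_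
        · intro h; rw [h] at hy; nlinarith
        · rw [show z.im ^ 2 = ω ^ 2 from hy]; linear_combination hq
        · rw [hy]; linarith
    obtain ⟨t, ht1, ht2⟩ := (hev.and (Ioc_mem_nhdsGT hsτ)).exists
    exact absurd (hmax ⟨⟨hs1.trans ht2.1.le, ht2.2⟩, ht1⟩) (not_le.2 ht2.1)
  · intro hlt hP
    obtain ⟨s, ⟨⟨hs1, hs2⟩, z, hz, hr⟩, hmin⟩ :=
      (chP_compact a b c d ha hb hc hd0 0 τ le_rfl).exists_isLeast ⟨τ, ⟨hτ.le, le_rfl⟩, hP⟩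
    have hs0 : 0 < s := by
      refine lt_of_le_of_ne hs1 ?_
      rintro rfl
      exact ch_zero_delay a b c d ha hb hc hd0 ⟨z, hz, hr⟩
    rcases hr.lt_or_eq with hr | hr
    · have hev : ∀ᶠ t in 𝓝[<] s, chP a b c d t :=
        (chP_open a b c d hc hd0 s z hz hr).filter_mono nhdsWithin_le_nhds
      obtain ⟨t, ht1, ht2⟩ := (hev.and (Ico_mem_nhdsLT hs0)).exists
      exact absurd (hmin ⟨⟨ht2.1, ht2.2.le.trans hs2⟩, ht1⟩) (not_le.2 ht2.2)
    · rw [hform z hr.symm] at hz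
      obtain ⟨-, hcos⟩ := haxis s _ hz
      have h1 : ω * s < Real.arccos C := (hτ1 s).1 (lt_of_le_of_lt hs2 hlt)
      have h2 : Real.arccos C = ω * s := by
        rw [← hcos, Real.arccos_cos (by positivity) (h1.le.trans (Real.arccos_le_pi _))]
      linarith
end

section
/- Let a, β₀, τ be real numbers and κ₀ > 0. Suppose λ : ℝ → ℂ is differentiable at κ₀ and satisfies λ(κ) + κ a + κ β₀ e^{−λ(κ) τ} = 0 for all κ in a neighbourhood of κ₀. If 1 + λ(κ₀) τ + κ₀ a τ ≠ 0, then λ′(κ₀) = λ(κ₀) / ( κ₀ (1 + λ(κ₀) τ + κ₀ a τ) ). -/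
/-- If a differentiable branch of characteristic roots `λ(κ)` satisfies
`λ(κ) + κa + κβ₀ e^{-λ(κ)τ} = 0` near `κ₀ > 0`, and
`1 + λ(κ₀)τ + κ₀aτ ≠ 0`, then
`λ'(κ₀) = λ(κ₀) / (κ₀ (1 + λ(κ₀)τ + κ₀aτ))`. -/
theorem stmt16 (a β₀ τ κ₀ : ℝ) (hκ : 0 < κ₀) (l : ℝ → ℂ)
    (hdiff : DifferentiableAt ℝ l κ₀)
    (heq : ∀ᶠ κ in nhds κ₀,
      l κ + ((κ * a : ℝ) : ℂ) + ((κ * β₀ : ℝ) : ℂ) * Complex.exp (-(l κ * (τ : ℂ))) = 0)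
    (hne : (1 : ℂ) + l κ₀ * (τ : ℂ) + ((κ₀ * a * τ : ℝ) : ℂ) ≠ 0) :
    deriv l κ₀ =
      l κ₀ / ((κ₀ : ℂ) * (1 + l κ₀ * (τ : ℂ) + ((κ₀ * a * τ : ℝ) : ℂ))) := by
  have h0 := heq.self_of_nhds
  have hl := hdiff.hasDerivAt
  have hid : HasDerivAt (fun κ : ℝ => (κ : ℂ)) 1 κ₀ := by
    simpa using (hasDerivAt_id κ₀).ofReal_comp
  have hE : HasDerivAt (fun κ : ℝ => Complex.exp (-(l κ * (τ : ℂ))))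
      (Complex.exp (-(l κ₀ * (τ : ℂ))) * (-(deriv l κ₀ * (τ : ℂ)))) κ₀ :=
    ((hl.mul_const (τ : ℂ)).fun_neg).cexp
  have hF := (hl.fun_add (hid.mul_const (a : ℂ))).fun_add ((hid.mul_const (β₀ : ℂ)).fun_mul hE)
  have hZ : HasDerivAt (fun _ : ℝ => (0 : ℂ)) 0 κ₀ := hasDerivAt_const _ _
  have h1 := hF.unique (hZ.congr_of_eventuallyEq (by
    filter_upwards [heq] with κ h
    push_cast at h
    exact h))
  have hk : (κ₀ : ℂ) ≠ 0 := by exact_mod_cast hκ.ne'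
  rw [eq_div_iff (mul_ne_zero hk hne)]
  push_cast at h0 ⊢
  linear_combination (κ₀ : ℂ) * h1 - h0 + (κ₀ : ℂ) * (τ : ℂ) * deriv l κ₀ * h0
end

section
/- Let a ≥ 0, β₀ ∈ ℝ, τ₀ > 0 and κ_c > 0. Suppose λ : ℝ → ℂ is differentiable at κ_c, satisfies λ(κ) + κ a + κ β₀ e^{−λ(κ) τ₀} = 0 for all κ in a neighbourhood of κ_c, and λ(κ_c) = iω₁ with ω₁ > 0 real. Then Re λ′(κ_c) = ω₁² τ₀ / ( κ_c ( (1 + κ_c a τ₀)² + (ω₁ τ₀)² ) ) > 0, so the pair of complex conjugate roots crosses the imaginary axis with strictly positive velocity at κ = κ_c. -/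
/-- Transversality of the Hopf spectrum: if a differentiable branch of
characteristic roots `λ(κ)` satisfies `λ(κ) + κa + κβ₀ e^{-λ(κ)τ₀} = 0` near
`κ_c > 0` and `λ(κ_c) = iω₁` with `ω₁ > 0`, then
`Re λ'(κ_c) = ω₁²τ₀ / (κ_c((1 + κ_c a τ₀)² + (ω₁τ₀)²)) > 0`. -/
theorem stmt17 (a β₀ τ₀ κc ω₁ : ℝ) (ha : 0 ≤ a) (hτ : 0 < τ₀) (hκ : 0 < κc)
    (hω : 0 < ω₁) (l : ℝ → ℂ) (hdiff : DifferentiableAt ℝ l κc)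
    (heq : ∀ᶠ κ in nhds κc,
      l κ + ((κ * a : ℝ) : ℂ) + ((κ * β₀ : ℝ) : ℂ) * Complex.exp (-(l κ * (τ₀ : ℂ))) = 0)
    (hiω : l κc = Complex.I * (ω₁ : ℂ)) :
    (deriv l κc).re =
      ω₁ ^ 2 * τ₀ / (κc * ((1 + κc * a * τ₀) ^ 2 + (ω₁ * τ₀) ^ 2)) ∧
    0 < (deriv l κc).re := by
  have h0 := heq.self_of_nhds
  have hl := hdiff.hasDerivAt
  set D := deriv l κc with hD
  have h1 : HasDerivAt (fun κ : ℝ => ((κ * a : ℝ) : ℂ)) (((1 * a : ℝ)) : ℂ) κc :=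
    ((hasDerivAt_id κc).mul_const a).ofReal_comp
  have h2 : HasDerivAt (fun κ : ℝ => ((κ * β₀ : ℝ) : ℂ)) (((1 * β₀ : ℝ)) : ℂ) κc :=
    ((hasDerivAt_id κc).mul_const β₀).ofReal_comp
  have h3 := ((hl.mul_const (τ₀ : ℂ)).fun_neg).cexp
  have h4 := (hl.fun_add h1).fun_add (h2.fun_mul h3)
  have h5 := (h4.congr_of_eventuallyEq (f₁ := fun _ : ℝ => (0 : ℂ))
    (by filter_upwards [heq] with κ hk using hk.symm)).unique (hasDerivAt_const κc (0 : ℂ))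
  rw [hiω] at h0 h5
  generalize Complex.exp (-(Complex.I * (ω₁ : ℂ) * (τ₀ : ℂ))) = E at h0 h5
  push_cast at h0 h5
  have h6 : (κc : ℂ) * (D * (1 + κc * a * τ₀ + Complex.I * (ω₁ * τ₀))) = Complex.I * ω₁ := by
    linear_combination (κc : ℂ) * h5 + (κc * D * τ₀ - 1) * h0
  have hr := congrArg Complex.re h6
  have hi := congrArg Complex.im h6
  simp at hr hi
  have hr' : D.re * (1 + κc * a * τ₀) - D.im * (ω₁ * τ₀) = 0 := by
    rcases hr with hr | hr
    · exact absurd hr hκ.ne'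
    · exact hr
  have hpos : 0 < κc * ((1 + κc * a * τ₀) ^ 2 + (ω₁ * τ₀) ^ 2) := by positivity
  have hx : D.re = ω₁ ^ 2 * τ₀ / (κc * ((1 + κc * a * τ₀) ^ 2 + (ω₁ * τ₀) ^ 2)) := by
    rw [eq_div_iff hpos.ne']
    linear_combination κc * (1 + κc * a * τ₀) * hr' + ω₁ * τ₀ * hi
  refine ⟨hx, ?_⟩
  rw [hx]
  positivity
end

section
/- Let α > 0, β > 0, C > 0, τ > 0, B > 0 and k < 2 be real numbers. Then there exists a unique w* > 0 satisfying α (w*)^{k−1} (1 − (w*/(Cτ))^B) = β w* (w*/(Cτ))^B, and moreover 0 < w* < Cτ. -/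
/-- For `α, β, C, τ, B > 0` and `k < 2`, there is a unique `w* > 0` with
`α (w*)^{k-1} (1 - (w*/(Cτ))^B) = β w* (w*/(Cτ))^B`, and `0 < w* < Cτ`. -/
theorem stmt18 (α β C τ B k : ℝ) (hα : 0 < α) (hβ : 0 < β) (hC : 0 < C)
    (hτ : 0 < τ) (hB : 0 < B) (hk : k < 2) :
    ∃ w : ℝ, 0 < w ∧
      α * w ^ (k - 1) * (1 - (w / (C * τ)) ^ B) = β * w * (w / (C * τ)) ^ B ∧
      w < C * τ ∧
      ∀ v : ℝ, 0 < v →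
        α * v ^ (k - 1) * (1 - (v / (C * τ)) ^ B) = β * v * (v / (C * τ)) ^ B →
        v = w := by
  have hM : 0 < C * τ := mul_pos hC hτ
  generalize C * τ = M at hM ⊢
  have hk2 : 0 < 2 - k := by linarith
  let F : ℝ → ℝ := fun w => (α + β * w ^ (2 - k)) * (w / M) ^ B
  have key : ∀ w : ℝ, 0 < w →
      (α * w ^ (k - 1) * (1 - (w / M) ^ B) = β * w * (w / M) ^ B ↔ F w = α) := by
    intro w hw
    have hp : 0 < w ^ (k - 1) := Real.rpow_pos_of_pos hw _
    have h1 : w = w ^ (k - 1) * w ^ (2 - k) := by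
      rw [← Real.rpow_add hw]
      have : k - 1 + (2 - k) = 1 := by ring
      rw [this, Real.rpow_one]
    have h2 : β * w * (w / M) ^ B = w ^ (k - 1) * (β * w ^ (2 - k) * (w / M) ^ B) := by
      linear_combination (β * (w / M) ^ B) * h1
    have h3 : α * w ^ (k - 1) * (1 - (w / M) ^ B)
        = w ^ (k - 1) * (α * (1 - (w / M) ^ B)) := by ring
    rw [h2, h3, mul_right_inj' hp.ne']
    simp only [F]
    constructor <;> intro h <;> linarith
  have mono : ∀ u v : ℝ, 0 < u → u < v → F u < F v := by
    intro u v hu huv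
    have h1 : u ^ (2 - k) < v ^ (2 - k) := Real.rpow_lt_rpow hu.le huv hk2
    have h2 : (u / M) ^ B < (v / M) ^ B :=
      Real.rpow_lt_rpow (by positivity) (by gcongr) hB
    have h3 : 0 < u ^ (2 - k) := Real.rpow_pos_of_pos hu _
    have h4 : 0 < (u / M) ^ B := Real.rpow_pos_of_pos (by positivity) _
    simp only [F]
    gcongr
  have hcont : Continuous F := by
    have h1 : Continuous fun w : ℝ => w ^ (2 - k) :=
      Real.continuous_rpow_const hk2.le
    have h2 : Continuous fun w : ℝ => (w / M) ^ B :=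
      (Real.continuous_rpow_const hB.le).comp (continuous_id.div_const M)
    exact (continuous_const.add (continuous_const.mul h1)).mul h2
  have hF0 : F 0 = 0 := by simp [F, Real.zero_rpow hB.ne']
  have hFM : α < F M := by
    have : 0 < M ^ (2 - k) := Real.rpow_pos_of_pos hM _
    simp only [F, div_self hM.ne', Real.one_rpow, mul_one]
    have := mul_pos hβ this
    linarith
  obtain ⟨w, ⟨hw0, hwM⟩, hw⟩ := intermediate_value_Ioo hM.le hcont.continuousOn
    (show α ∈ Set.Ioo (F 0) (F M) from ⟨by rw [hF0]; exact hα, hFM⟩)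
  refine ⟨w, hw0, (key w hw0).2 hw, hwM, fun v hv h => ?_⟩
  have hv' := (key v hv).1 h
  rcases lt_trichotomy v w with h | h | h
  · have := mono v w hv h
    linarith
  · exact h
  · have := mono w v hw0 h
    linarith
end
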